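/- Let X be a Stone L-space. Then cen U = core U for every clopen upset U of X. -/

import Mathlib

open Set Topology

/-- Clopen upsets of a topological space with a partial order. -/
def ClopUp (X : Type*) [TopologicalSpace X] [Preorder X] : Set (Set X) :=
  {U | IsClopen U ∧ IsUpperSet U}

/-- Downward closure of a set. -/
def downClosure (X : Type*) [Preorder X] (A : Set X) : Set X := {x | ∃ y ∈ A, x ≤ y}

/-- Priestley space: compact, and clopen upsets separate points via the Priestley separation axiom. -/
def IsPriestley (X : Type*) [TopologicalSpace X] [Preorder X] : Prop :=
  CompactSpace X ∧ ∀ x y : X, ¬x ≤ y → ∃ U ∈ ClopUp X, x ∈ U ∧ y ∉ U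

/-- Esakia space: a Priestley space in which downward closures of clopens are clopen. -/
def IsEsakia (X : Type*) [TopologicalSpace X] [Preorder X] : Prop :=
  IsPriestley X ∧ ∀ U : Set X, IsClopen U → IsClopen (downClosure X U)

/-- L-space: an extremally order-disconnected Esakia space. -/
def IsLSpace (X : Type*) [TopologicalSpace X] [Preorder X] : Prop :=
  IsEsakia X ∧ ∀ U : Set X, IsOpen U → IsUpperSet U → IsOpen (closure U)

/-- The spatial part of an L-space: points with clopen downset. -/
def spatialPart (X : Type*) [TopologicalSpace X] [Preorder X] : Set X :=
  {y : X | IsClopen {x : X | x ≤ y}}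

/-- Scott upset: a closed upset all of whose minimal points lie in the spatial part. -/
def IsScottUpset (X : Type*) [TopologicalSpace X] [Preorder X] (F : Set X) : Prop :=
  IsClosed F ∧ IsUpperSet F ∧ ∀ y ∈ F, (∀ z ∈ F, z ≤ y → z = y) → y ∈ spatialPart X

/-- Clopen Scott upsets. -/
def ClopSUp (X : Type*) [TopologicalSpace X] [Preorder X] : Set (Set X) :=
  {U | IsClopen U ∧ IsScottUpset X U}

/-- Clopen bisets (both upsets and downsets). -/
def ClopBi (X : Type*) [TopologicalSpace X] [Preorder X] : Set (Set X) :=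
  {U | IsClopen U ∧ IsUpperSet U ∧ IsLowerSet U}

/-- `V ≪ U` for clopen upsets: every open upset whose closure contains `U` contains `V`. -/
def wayBelowSet (X : Type*) [TopologicalSpace X] [Preorder X] (V U : Set X) : Prop :=
  ∀ W : Set X, IsOpen W → IsUpperSet W → U ⊆ closure W → V ⊆ W

/-- The kernel of a clopen upset. -/
def kerSet (X : Type*) [TopologicalSpace X] [Preorder X] (U : Set X) : Set X :=
  ⋃₀ {V | V ∈ ClopUp X ∧ wayBelowSet X V U}

/-- The core of a clopen upset. -/
def coreSet (X : Type*) [TopologicalSpace X] [Preorder X] (U : Set X) : Set X :=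
  ⋃₀ {V | V ∈ ClopSUp X ∧ V ⊆ U}

/-- The regular part of a clopen upset. -/
def regSet (X : Type*) [TopologicalSpace X] [Preorder X] (U : Set X) : Set X :=
  ⋃₀ {V | V ∈ ClopUp X ∧ downClosure X V ⊆ U}

/-- The center of a clopen upset. -/
def cenSet (X : Type*) [TopologicalSpace X] [Preorder X] (U : Set X) : Set X :=
  ⋃₀ {V | V ∈ ClopBi X ∧ V ⊆ U}

/-- The topology on the spatial part, generated by traces of clopen upsets. -/
def spatialTop (X : Type*) [TopologicalSpace X] [Preorder X] :
    TopologicalSpace (spatialPart X) :=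
  TopologicalSpace.generateFrom
    {V : Set (spatialPart X) | ∃ U ∈ ClopUp X, V = ((↑) : spatialPart X → X) ⁻¹' U}

/-- An algebraic L-space: the core of every clopen upset is dense in it. -/
def IsAlgebraicLSpace (X : Type*) [TopologicalSpace X] [Preorder X] : Prop :=
  IsLSpace X ∧ ∀ U ∈ ClopUp X, U ⊆ closure (coreSet X U)

/-- A space is compactly based if compact open sets form a basis. -/
def CompactlyBased (Y : Type*) [TopologicalSpace Y] : Prop :=
  ∀ V : Set Y, IsOpen V → ∀ y ∈ V, ∃ K : Set Y, IsOpen K ∧ IsCompact K ∧ y ∈ K ∧ K ⊆ V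

/-- A set is saturated if it is the intersection of the open sets containing it. -/
def IsSaturatedSet {Y : Type*} [TopologicalSpace Y] (K : Set Y) : Prop :=
  K = ⋂₀ {U : Set Y | IsOpen U ∧ K ⊆ U}

/-- The way-below relation in a frame. -/
def frameWayBelow {L : Type*} [Order.Frame L] (a b : L) : Prop :=
  ∀ S : Set L, b ≤ sSup S → ∃ T : Set L, T ⊆ S ∧ T.Finite ∧ a ≤ sSup T

/-- A compact element of a frame. -/
def IsCompactElt {L : Type*} [Order.Frame L] (a : L) : Prop := frameWayBelow a a

/-- An algebraic frame: every element is the join of the compact elements below it. -/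
def AlgebraicFrame (L : Type*) [Order.Frame L] : Prop :=
  ∀ a : L, a = sSup {k : L | IsCompactElt k ∧ k ≤ a}

/-- An arithmetic frame: algebraic with stable way-below relation. -/
def ArithmeticFrame (L : Type*) [Order.Frame L] : Prop :=
  AlgebraicFrame L ∧
    ∀ a b c : L, frameWayBelow a b → frameWayBelow a c → frameWayBelow a (b ⊓ c)

/-- A coherent frame: arithmetic and compact. -/
def CoherentFrame (L : Type*) [Order.Frame L] : Prop :=
  ArithmeticFrame L ∧ IsCompactElt (⊤ : L)

/-- A prime filter of a frame. -/
def IsPrimeFilter {L : Type*} [Order.Frame L] (F : Set L) : Prop :=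
  F.Nonempty ∧ F ≠ Set.univ ∧ (∀ a ∈ F, ∀ b : L, a ≤ b → b ∈ F) ∧
    (∀ a ∈ F, ∀ b ∈ F, a ⊓ b ∈ F) ∧ ∀ a b : L, a ⊔ b ∈ F → a ∈ F ∨ b ∈ F

/-- A completely prime filter of a frame. -/
def IsCompletelyPrimeFilter {L : Type*} [Order.Frame L] (F : Set L) : Prop :=
  F.Nonempty ∧ F ≠ Set.univ ∧ (∀ a ∈ F, ∀ b : L, a ≤ b → b ∈ F) ∧
    (∀ a ∈ F, ∀ b ∈ F, a ⊓ b ∈ F) ∧ ∀ S : Set L, sSup S ∈ F → ∃ s ∈ S, s ∈ F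

/-- The Priestley space of a frame: prime filters ordered by inclusion. -/
abbrev PriestleyDual (L : Type*) [Order.Frame L] : Type _ := {F : Set L // IsPrimeFilter F}

/-- The Priestley topology on the Priestley space of a frame. -/
instance PriestleyDual.instTopologicalSpace (L : Type*) [Order.Frame L] :
    TopologicalSpace (PriestleyDual L) :=
  TopologicalSpace.generateFrom
    ({S : Set (PriestleyDual L) | ∃ a : L, S = {x | a ∈ x.val}} ∪
     {S : Set (PriestleyDual L) | ∃ a : L, S = {x | a ∈ x.val}ᶜ})

section Priestley

variable {X : Type*} [TopologicalSpace X]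

theorem IsPriestley.isClosed_Iic [Preorder X] (hX : IsPriestley X) (x : X) :
    IsClosed (Iic x) := by
  rw [← isOpen_compl_iff, isOpen_iff_forall_mem_open]
  intro z hz
  obtain ⟨U, hU, hzU, hxU⟩ := hX.2 z x hz
  exact ⟨U, fun w hw hwx => hxU (hU.2 hwx hw), hU.1.isOpen, hzU⟩

/-- In a Priestley space, every point of a closed set lies above a minimal point of that set. -/
theorem IsPriestley.exists_minimal_le [PartialOrder X] (hX : IsPriestley X) {F : Set X}
    (hF : IsClosed F) {x : X} (hx : x ∈ F) :
    ∃ m ∈ F, m ≤ x ∧ ∀ z ∈ F, z ≤ m → z = m := by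
  have := hX.1
  obtain ⟨m, hxm, hm⟩ := zorn_le_nonempty₀ (α := Xᵒᵈ) (OrderDual.ofDual ⁻¹' F) (by
    intro c hcF hc y hy
    have : Nonempty c := ⟨⟨y, hy⟩⟩
    obtain ⟨b, hb⟩ :=
      IsCompact.nonempty_iInter_of_directed_nonempty_isCompact_isClosed
        (fun i : c => F ∩ Iic (OrderDual.ofDual i.1))
        (by
          intro i j
          rcases hc.total i.2 j.2 with h | h
          · exact ⟨j, fun z hz => ⟨hz.1, le_trans hz.2 h⟩, subset_rfl⟩
          · exact ⟨i, subset_rfl, fun z hz => ⟨hz.1, le_trans hz.2 h⟩⟩)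
        (fun i => ⟨OrderDual.ofDual i.1, hcF i.2, le_rfl⟩)
        (fun i => (hF.inter (hX.isClosed_Iic _)).isCompact)
        (fun i => hF.inter (hX.isClosed_Iic _))
    rw [mem_iInter] at hb
    exact ⟨OrderDual.toDual b, (hb ⟨y, hy⟩).1, fun z hz => (hb ⟨z, hz⟩).2⟩)
    (OrderDual.toDual x) hx
  exact ⟨OrderDual.ofDual m, hm.1, hxm, fun z hz hzm => le_antisymm hzm (hm.2 hz hzm)⟩

/-- A clopen Scott upset is contained in every upset that is dense in it. -/
theorem IsPriestley.subset_of_mem_clopSUp [PartialOrder X] (hX : IsPriestley X) {V W : Set X}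
    (hV : V ∈ ClopSUp X) (hW : IsUpperSet W) (hVW : V ⊆ closure W) : V ⊆ W := by
  intro x hx
  obtain ⟨m, hmV, hmx, hm⟩ := hX.exists_minimal_le hV.2.1 hx
  have hmY : IsClopen {z : X | z ≤ m} := hV.2.2.2 m hmV hm
  obtain ⟨w, hwm, hwW⟩ := mem_closure_iff.1 (hVW hmV) _ hmY.isOpen le_rfl
  exact hW (le_trans hwm hmx) hwW

/-- If the kernel of the whole space is everything, then dense open upsets are everything. -/
theorem eq_univ_of_kerSet_eq_univ [Preorder X] (hK : kerSet X univ = univ) {W : Set X}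
    (hWo : IsOpen W) (hW : IsUpperSet W) (hWd : Dense W) : W = univ := by
  refine eq_univ_of_forall fun x => ?_
  obtain ⟨V, ⟨-, hV⟩, hxV⟩ : x ∈ kerSet X univ := hK.symm.subset (mem_univ x)
  exact hV W hWo hW (fun y _ => hWd y) hxV

theorem IsPriestley.mem_spatialPart_of_isMin [PartialOrder X] (hX : IsPriestley X)
    (hK : kerSet X univ = univ) {y : X} (hy : IsMin y) : y ∈ spatialPart X := by
  have hIic : {x : X | x ≤ y} = {y} :=
    Subset.antisymm (fun z hz => hy.eq_of_le hz) (fun z hz => le_of_eq hz)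
  have hcl : IsClosed ({y} : Set X) := hIic ▸ hX.isClosed_Iic y
  have hup : IsUpperSet ({y}ᶜ : Set X) := fun a b hab ha hb =>
    ha (hy.eq_of_le (hab.trans_eq hb))
  change IsClopen {x : X | x ≤ y}
  rw [hIic]
  refine ⟨hcl, not_not.1 fun hno => ?_⟩
  have hd : Dense ({y}ᶜ : Set X) := dense_compl_singleton_iff_not_open.2 hno
  have := eq_univ_of_kerSet_eq_univ hK hcl.isOpen_compl hup hd
  exact (this ▸ mem_univ y : y ∈ ({y}ᶜ : Set X)) rfl

theorem IsPriestley.clopBi_subset_clopSUp [PartialOrder X] (hX : IsPriestley X)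
    (hK : kerSet X univ = univ) : ClopBi X ⊆ ClopSUp X := by
  rintro V ⟨hV, hup, hlow⟩
  refine ⟨hV, hV.isClosed, hup, fun y hy hmin => hX.mem_spatialPart_of_isMin hK ?_⟩
  exact fun z hz => (hmin z (hlow hz hy) hz).ge

end Priestley

/-- in a Stone L-space, the center and the core of a clopen upset coincide. -/
theorem stmt15 {X : Type*} [TopologicalSpace X] [PartialOrder X]
    (hX : IsLSpace X) (hK : kerSet X Set.univ = Set.univ)
    (hcen : ∀ U ∈ ClopUp X, U ⊆ closure (cenSet X U)) :
    ∀ U ∈ ClopUp X, cenSet X U = coreSet X U := by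
  have hP := hX.1.1
  refine fun U _ => Subset.antisymm ?_ ?_
  · exact sUnion_subset_sUnion fun V hV => ⟨hP.clopBi_subset_clopSUp hK hV.1, hV.2⟩
  · refine sUnion_subset fun V hV => ?_
    have hVcen : V ⊆ cenSet X V :=
      hP.subset_of_mem_clopSUp hV.1 (isUpperSet_sUnion fun B hB => hB.1.2.1)
        (hcen V ⟨hV.1.1, hV.1.2.2.1⟩)
    exact hVcen.trans (sUnion_subset_sUnion fun B hB => ⟨hB.1, hB.2.trans hV.2⟩)
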